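/- Let N ≥ 3 be an integer, 2* = 2N/(N−2), Ω ⊆ ℝ^N an open set, Q ∈ C¹(Ω), ε ≥ 0, s ≥ 1, and let u ∈ C²(Ω) be positive on Ω and satisfy −Δu = Q(x) u^{2*−1} + ε u^s in Ω. Then for every closed ball B̄_r(x₀) ⊂ Ω and every base point b ∈ ℝ^N: (1/2*) ∫_{B_r(x₀)} ((x−b)·∇Q(x)) u^{2*} dx + (1 − N/2 + N/(1+s)) ε ∫_{B_r(x₀)} u^{s+1} dx = ∫_{∂B_r(x₀)} [ ( (1/2*) Q u^{2*} + (ε/(s+1)) u^{s+1} − (1/2)|∇u|² ) ((x−b)·ν) + ( (x−b)·∇u + ((N−2)/2) u ) (∂u/∂ν) ] dσ, where ν(x) = (x−x₀)/r is the outward unit normal and σ is the (N−1)-dimensional surface measure on ∂B_r(x₀). -/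

import Mathlib

open MeasureTheory Metric Real Filter Topology Set RealInnerProductSpace

noncomputable section

/-- The Laplacian of `u : ℝ^N → ℝ`, as the sum of the second partial derivatives
in the coordinate directions. -/
def laplacian {N : ℕ} (u : EuclideanSpace ℝ (Fin N) → ℝ)
    (x : EuclideanSpace ℝ (Fin N)) : ℝ :=
  ∑ i : Fin N,
    fderiv ℝ (fun y => fderiv ℝ u y (EuclideanSpace.single i 1)) x (EuclideanSpace.single i 1)

/-- The surface integral of `f` over the sphere of center `x₀` and radius `r` in `ℝ^N`,
with respect to the `(N-1)`-dimensional surface measure: it is expressed by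
parametrizing the sphere by the unit sphere via `θ ↦ x₀ + r • θ` and scaling the
standard surface measure `volume.toSphere` of the unit sphere by `r ^ (N-1)`.
The function `f` receives the point of the sphere and the outward unit normal `ν = θ`. -/
def sphereIntegral (N : ℕ) (x₀ : EuclideanSpace ℝ (Fin N)) (r : ℝ)
    (f : EuclideanSpace ℝ (Fin N) → EuclideanSpace ℝ (Fin N) → ℝ) : ℝ :=
  r ^ (N - 1) *
    ∫ θ : Metric.sphere (0 : EuclideanSpace ℝ (Fin N)) 1,
      f (x₀ + r • (θ : EuclideanSpace ℝ (Fin N))) (θ : EuclideanSpace ℝ (Fin N))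
      ∂((volume : Measure (EuclideanSpace ℝ (Fin N))).toSphere)

section DivergenceTheorem

variable {E : Type*} [NormedAddCommGroup E] [InnerProductSpace ℝ E] [FiniteDimensional ℝ E]
  [MeasurableSpace E] [BorelSpace E]

/-- Integration in polar coordinates. -/
lemma integral_eq_integral_Ioi_integral_sphere [Nontrivial E] {F : E → ℝ} (hF : Integrable F) :
    ∫ x, F x = ∫ y in Ioi (0 : ℝ), y ^ (Module.finrank ℝ E - 1) *
      ∫ θ : sphere (0 : E) 1, F (y • (θ : E)) ∂(volume : Measure E).toSphere := by
  set n := Module.finrank ℝ E - 1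
  set μ : Measure E := volume
  set e := homeomorphUnitSphereProd E
  have hmp := μ.measurePreserving_homeomorphUnitSphereProd
  have he : ∀ x : ({0}ᶜ : Set E), ((e x).2 : ℝ) • ((e x).1 : E) = x := fun x => by
    rw [homeomorphUnitSphereProd_apply_fst_coe, homeomorphUnitSphereProd_apply_snd_coe,
      smul_inv_smul₀ (norm_ne_zero_iff.2 x.2)]
  have hint : Integrable (fun p : sphere (0 : E) 1 × Ioi (0 : ℝ) => F ((p.2 : ℝ) • (p.1 : E)))
      (μ.toSphere.prod (.volumeIoiPow n)) := by
    rw [← hmp.integrable_comp_emb (Homeomorph.measurableEmbedding _)]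
    have h1 : Integrable (fun x : ({0}ᶜ : Set E) => F x) (μ.comap (↑)) := by
      have := (integrableOn_iff_comap_subtypeVal (f := F) (μ := μ)
        (measurableSet_singleton (0 : E)).compl).1 hF.integrableOn
      exact this
    refine h1.congr (Eventually.of_forall fun x => ?_)
    exact congrArg F (he x).symm
  calc
    ∫ x, F x = ∫ x : ({(0)}ᶜ : Set E), F x ∂(μ.comap (↑)) := by
      rw [integral_subtype_comap (measurableSet_singleton _).compl fun x ↦ F x,
        restrict_compl_singleton]
    _ = ∫ p : sphere (0 : E) 1 × Ioi (0 : ℝ), F ((p.2 : ℝ) • (p.1 : E))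
          ∂μ.toSphere.prod (.volumeIoiPow n) := by
      rw [← hmp.integral_comp (Homeomorph.measurableEmbedding _)]
      refine integral_congr_ae (Eventually.of_forall fun x => ?_)
      exact congrArg F (he x).symm
    _ = ∫ y : Ioi (0 : ℝ), ∫ θ : sphere (0 : E) 1, F ((y : ℝ) • (θ : E)) ∂μ.toSphere
          ∂.volumeIoiPow n := integral_prod_symm _ hint
    _ = _ := by
      simp only [Measure.volumeIoiPow, ENNReal.ofReal]
      rw [integral_withDensity_eq_integral_smul,
        integral_subtype_comap measurableSet_Ioi fun a ↦ Real.toNNReal (a ^ n) •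
          ∫ θ : sphere (0 : E) 1, F (a • (θ : E)) ∂μ.toSphere,
        setIntegral_congr_fun measurableSet_Ioi fun x hx ↦ ?_]
      · rw [NNReal.smul_def, Real.coe_toNNReal _ (pow_nonneg hx.out.le _), smul_eq_mul]
      · exact (measurable_subtype_coe.pow_const _).real_toNNReal

lemma continuous_integral_sphere {F : E → ℝ} (hF : Continuous F) :
    Continuous fun y : ℝ =>
      ∫ θ : sphere (0 : E) 1, F (y • (θ : E)) ∂(volume : Measure E).toSphere := by
  have h := continuous_parametric_integral_of_continuous
    (μ := (volume : Measure E).toSphere) (f := fun (y : ℝ) (θ : sphere (0 : E) 1) => F (y • (θ : E)))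
    (by fun_prop) isCompact_univ
  simpa using h

lemma setIntegral_ball_eq_integral_integral_sphere [Nontrivial E] {F : E → ℝ}
    (hF : Continuous F) {R : ℝ} (hR : 0 ≤ R) :
    ∫ x in ball (0 : E) R, F x = ∫ y in (0 : ℝ)..R, y ^ (Module.finrank ℝ E - 1) *
      ∫ θ : sphere (0 : E) 1, F (y • (θ : E)) ∂(volume : Measure E).toSphere := by
  have hint : Integrable ((ball (0 : E) R).indicator F) :=
    (integrable_indicator_iff measurableSet_ball).2
      ((hF.continuousOn.integrableOn_compact (isCompact_closedBall 0 R)).mono_set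
        ball_subset_closedBall)
  rw [← integral_indicator measurableSet_ball, integral_eq_integral_Ioi_integral_sphere hint,
    intervalIntegral.integral_of_le hR, ← integral_Ioc_eq_integral_Ioo.symm,
    ← Ioi_inter_Iio, ← setIntegral_indicator measurableSet_Iio]
  refine setIntegral_congr_fun measurableSet_Ioi fun y (hy : 0 < y) => ?_
  have hmem : ∀ θ : sphere (0 : E) 1, y • (θ : E) ∈ ball (0 : E) R ↔ y < R := fun θ => by
    simp [norm_smul, abs_of_pos hy]
  by_cases hyR : y < R <;> simp [indicator, hyR, hmem]

lemma hasDerivAt_max_zero_sq (t : ℝ) :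
    HasDerivAt (fun t : ℝ => (max t 0) ^ 2) (2 * max t 0) t := by
  rcases lt_trichotomy t 0 with h | rfl | h
  · have : (fun t : ℝ => (max t 0) ^ 2) =ᶠ[𝓝 t] fun _ => 0 := by
      filter_upwards [Iio_mem_nhds h] with y hy
      simp [max_eq_right (le_of_lt (mem_Iio.1 hy))]
    rw [max_eq_right h.le, mul_zero]
    exact (hasDerivAt_const t (0 : ℝ)).congr_of_eventuallyEq this
  · have h0 : (fun t : ℝ => (max t 0) ^ 2) =O[𝓝 0] fun t => ‖t - 0‖ ^ 2 := by
      refine Asymptotics.IsBigO.of_bound 1 (Eventually.of_forall fun y => ?_)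
      rcases le_total y 0 with hy | hy <;> simp [hy, sq_nonneg]
    simpa using (h0.hasFDerivAt one_lt_two).hasDerivAt
  · have : (fun t : ℝ => (max t 0) ^ 2) =ᶠ[𝓝 t] fun t => t ^ 2 := by
      filter_upwards [Ioi_mem_nhds h] with y hy
      simp [max_eq_left (le_of_lt (mem_Ioi.1 hy))]
    rw [max_eq_left h.le]
    simpa using (hasDerivAt_pow 2 t).congr_of_eventuallyEq this

lemma integral_ball_sq_mul_fderiv {F : E → ℝ} (hF : ContDiff ℝ 1 F) (e : E) (R : ℝ) :
    ∫ x in ball (0 : E) R, (R ^ 2 - ‖x‖ ^ 2) ^ 2 * fderiv ℝ F x e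
      = 4 * ∫ x in ball (0 : E) R, (R ^ 2 - ‖x‖ ^ 2) * (⟪x, e⟫ * F x) := by
  rcases le_or_gt R 0 with hR | hR
  · simp [ball_eq_empty.2 hR]
  set m : E → ℝ := fun x => max (R ^ 2 - ‖x‖ ^ 2) 0 with hm
  have hmc : Continuous m := by fun_prop
  have hm_in : ∀ x ∈ ball (0 : E) R, m x = R ^ 2 - ‖x‖ ^ 2 := fun x hx => by
    rw [mem_ball_zero_iff] at hx
    exact max_eq_left (by nlinarith [norm_nonneg x])
  have hm_out : ∀ x ∉ ball (0 : E) R, m x = 0 := fun x hx => by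
    rw [mem_ball_zero_iff, not_lt] at hx
    exact max_eq_right (by nlinarith [norm_nonneg x])
  have hms : HasCompactSupport m :=
    HasCompactSupport.intro (isCompact_closedBall (0 : E) R)
      fun x hx => hm_out x fun h => hx (ball_subset_closedBall h)
  have hmd : ∀ x, HasFDerivAt (fun x => m x ^ 2) ((-4 * m x) • innerSL ℝ x) x := fun x => by
    have h1 : HasFDerivAt (fun x : E => R ^ 2 - ‖x‖ ^ 2) (-(2 • innerSL ℝ x)) x :=
      (HasStrictFDerivAt.hasFDerivAt (hasStrictFDerivAt_norm_sq x)).const_sub _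
    have h2 := (hasDerivAt_max_zero_sq (R ^ 2 - ‖x‖ ^ 2)).comp_hasFDerivAt x h1
    refine h2.congr_fderiv ?_
    ext v
    simp [hm]
    ring
  have hmd' : ∀ x, fderiv ℝ (fun x => m x ^ 2) x e = -4 * (m x * ⟪x, e⟫) := fun x => by
    rw [(hmd x).fderiv]
    simp
    ring
  have hFc : Continuous fun x => fderiv ℝ F x e :=
    (hF.continuous_fderiv one_ne_zero).clm_apply continuous_const
  have hsq : HasCompactSupport fun x => m x ^ 2 := hms.comp_left (g := fun t : ℝ => t ^ 2) (by simp)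
  have key := integral_mul_fderiv_eq_neg_fderiv_mul_of_integrable (μ := (volume : Measure E))
    (f := fun x => m x ^ 2) (g := F) (v := e)
    (by
      simp only [hmd']
      refine Continuous.integrable_of_hasCompactSupport
        ((continuous_const.mul (hmc.mul (by fun_prop))).mul hF.continuous) ?_
      exact (hms.mul_right.mul_left).mul_right)
    (((hmc.pow 2).mul hFc).integrable_of_hasCompactSupport hsq.mul_right)
    (((hmc.pow 2).mul hF.continuous).integrable_of_hasCompactSupport hsq.mul_right)
    (fun x _ => (hmd x).differentiableAt)
    (fun x _ => hF.differentiable one_ne_zero x)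
  simp only [hmd'] at key
  have hball : ∀ {f : E → ℝ}, (∀ x, m x = 0 → f x = 0) → ∫ x in ball (0 : E) R, f x = ∫ x, f x :=
    fun hf => setIntegral_eq_integral_of_forall_compl_eq_zero fun x hx => hf x (hm_out x hx)
  rw [← hball fun x hx => by simp [hx], ← integral_neg, ← hball fun x hx => by simp [hx]] at key
  rw [← integral_const_mul]
  refine Eq.trans ?_ (key.trans ?_) <;>
    refine setIntegral_congr_fun measurableSet_ball fun x hx => ?_
  · simp only [hm_in x hx]
  · simp only [hm_in x hx]
    ring

lemma integral_eq_of_integral_sq_mul_eq {a c : ℝ → ℝ} (ha : Continuous a) (hc : Continuous c)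
    (h : ∀ R > 0, ∫ y in (0 : ℝ)..R, (R ^ 2 - y ^ 2) ^ 2 * a y
      = 4 * ∫ y in (0 : ℝ)..R, (R ^ 2 - y ^ 2) * (y * c y)) {R : ℝ} (hR : 0 < R) :
    ∫ y in (0 : ℝ)..R, a y = c R := by
  have hd : ∀ {f : ℝ → ℝ}, Continuous f → ∀ R, HasDerivAt (fun R => ∫ y in (0 : ℝ)..R, f y) (f R) R :=
    fun hf R => intervalIntegral.integral_hasDerivAt_right (hf.intervalIntegrable _ _)
      (hf.stronglyMeasurableAtFilter _ _) hf.continuousAt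
  have huniq : ∀ {f g : ℝ → ℝ} {f' g' R : ℝ}, 0 < R → (∀ R > 0, f R = g R) →
      HasDerivAt f f' R → HasDerivAt g g' R → f' = g' := fun hR hfg hf hg =>
    hf.unique (hg.congr_of_eventuallyEq
      (by filter_upwards [Ioi_mem_nhds hR] with y hy using hfg y hy))
  have ha2 : Continuous fun y => y ^ 2 * a y := by fun_prop
  have ha4 : Continuous fun y => y ^ 4 * a y := by fun_prop
  have hc1 : Continuous fun y => y * c y := by fun_prop
  have hc3 : Continuous fun y => y ^ 3 * c y := by fun_prop
  have h0 : ∀ R > 0, R ^ 4 * (∫ y in (0 : ℝ)..R, a y) - 2 * R ^ 2 * (∫ y in (0 : ℝ)..R, y ^ 2 * a y)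
      + ∫ y in (0 : ℝ)..R, y ^ 4 * a y
      = 4 * (R ^ 2 * (∫ y in (0 : ℝ)..R, y * c y) - ∫ y in (0 : ℝ)..R, y ^ 3 * c y) := by
    intro R hR
    have e1 : ∫ y in (0 : ℝ)..R, (R ^ 2 - y ^ 2) ^ 2 * a y
        = ∫ y in (0 : ℝ)..R, (R ^ 4 * a y - 2 * R ^ 2 * (y ^ 2 * a y) + y ^ 4 * a y) :=
      intervalIntegral.integral_congr fun y _ => by ring
    have e2 : ∫ y in (0 : ℝ)..R, (R ^ 2 - y ^ 2) * (y * c y)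
        = ∫ y in (0 : ℝ)..R, (R ^ 2 * (y * c y) - y ^ 3 * c y) :=
      intervalIntegral.integral_congr fun y _ => by ring
    have := h R hR
    rw [e1, e2, intervalIntegral.integral_add, intervalIntegral.integral_sub,
      intervalIntegral.integral_sub, intervalIntegral.integral_const_mul,
      intervalIntegral.integral_const_mul, intervalIntegral.integral_const_mul] at this
    · exact this
    all_goals exact Continuous.intervalIntegrable (by fun_prop) _ _
  have h1 : ∀ R > 0, R ^ 2 * (∫ y in (0 : ℝ)..R, a y) - (∫ y in (0 : ℝ)..R, y ^ 2 * a y)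
      = 2 * ∫ y in (0 : ℝ)..R, y * c y := by
    intro R hR
    have := huniq hR h0
      ((((hasDerivAt_pow 4 R).mul (hd ha R)).sub
        (((hasDerivAt_pow 2 R).const_mul 2).mul (hd ha2 R))).add (hd ha4 R))
      ((((hasDerivAt_pow 2 R).mul (hd hc1 R)).sub (hd hc3 R)).const_mul 4)
    refine mul_left_cancel₀ (mul_ne_zero four_ne_zero hR.ne') ?_
    norm_num at this
    linear_combination this
  have := huniq hR h1
    (((hasDerivAt_pow 2 R).mul (hd ha R)).sub (hd ha2 R)) ((hd hc1 R).const_mul 2)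
  refine mul_left_cancel₀ (mul_ne_zero two_ne_zero hR.ne') ?_
  norm_num at this
  linear_combination this

lemma integral_ball_zero_fderiv [Nontrivial E] {F : E → ℝ} (hF : ContDiff ℝ 1 F) (e : E) {R : ℝ}
    (hR : 0 < R) :
    ∫ x in ball (0 : E) R, fderiv ℝ F x e = R ^ (Module.finrank ℝ E - 1) *
      ∫ θ : sphere (0 : E) 1, ⟪(θ : E), e⟫ * F (R • (θ : E)) ∂(volume : Measure E).toSphere := by
  have hFc : Continuous fun x => fderiv ℝ F x e :=
    (hF.continuous_fderiv one_ne_zero).clm_apply continuous_const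
  have hF0 := hF.continuous
  have hcont : Continuous fun y : ℝ => ∫ θ : sphere (0 : E) 1, ⟪(θ : E), e⟫ * F (y • (θ : E))
      ∂(volume : Measure E).toSphere := by
    have h := continuous_parametric_integral_of_continuous (μ := (volume : Measure E).toSphere)
      (f := fun (y : ℝ) (θ : sphere (0 : E) 1) => ⟪(θ : E), e⟫ * F (y • (θ : E)))
      (by fun_prop) isCompact_univ
    simpa using h
  rw [setIntegral_ball_eq_integral_integral_sphere hFc hR.le]
  refine integral_eq_of_integral_sq_mul_eq (c := fun R => R ^ (Module.finrank ℝ E - 1) *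
      ∫ θ : sphere (0 : E) 1, ⟪(θ : E), e⟫ * F (R • (θ : E)) ∂(volume : Measure E).toSphere)
    ((continuous_pow _).mul (continuous_integral_sphere hFc)) ((continuous_pow _).mul hcont) ?_ hR
  intro R hR
  have key := integral_ball_sq_mul_fderiv hF e R
  rw [setIntegral_ball_eq_integral_integral_sphere (by fun_prop) hR.le,
    setIntegral_ball_eq_integral_integral_sphere (by fun_prop) hR.le] at key
  have hn : ∀ y ∈ uIcc 0 R, ∀ θ : sphere (0 : E) 1, ‖y • (θ : E)‖ = y := fun y hy θ => by
    rw [uIcc_of_le hR.le] at hy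
    simp [norm_smul, abs_of_nonneg hy.1]
  refine Eq.trans ?_ (key.trans (congrArg (4 * ·) ?_)) <;>
    refine intervalIntegral.integral_congr fun y hy => ?_
  · simp only [hn y hy, integral_const_mul, Pi.mul_apply]
    ring
  · simp only [hn y hy, integral_const_mul, real_inner_smul_left, mul_assoc]
    ring

/-- The divergence theorem on a ball, for a vector field `F • e` of constant direction. -/
theorem integral_ball_fderiv [Nontrivial E] {Ω : Set E} (hΩ : IsOpen Ω) {F : E → ℝ}
    (hF : ContDiffOn ℝ 1 F Ω) {x₀ : E} {r : ℝ} (hr : 0 < r) (hball : closedBall x₀ r ⊆ Ω) (e : E) :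
    ∫ x in ball x₀ r, fderiv ℝ F x e = r ^ (Module.finrank ℝ E - 1) *
      ∫ θ : sphere (0 : E) 1, ⟪(θ : E), e⟫ * F (x₀ + r • (θ : E))
        ∂(volume : Measure E).toSphere := by
  obtain ⟨δ, hδ, hδΩ⟩ := (isCompact_closedBall x₀ r).exists_cthickening_subset_open hΩ hball
  rw [cthickening_closedBall hδ.le hr.le] at hδΩ
  let χ : ContDiffBump x₀ := ⟨r, δ + r, hr, by linarith⟩
  set G : E → ℝ := fun x => χ x * F x with hG
  have hGd : ContDiff ℝ 1 G := by
    refine contDiff_iff_contDiffAt.2 fun x => ?_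
    by_cases hx : x ∈ Ω
    · exact χ.contDiff.contDiffAt.mul (hF.contDiffAt (hΩ.mem_nhds hx))
    · have hχ : χ =ᶠ[𝓝 x] 0 := by
        rw [← notMem_tsupport_iff_eventuallyEq, χ.tsupport_eq]
        exact fun h => hx (hδΩ h)
      refine (contDiffAt_const (c := (0 : ℝ))).congr_of_eventuallyEq ?_
      filter_upwards [hχ] with y hy
      simp [hG, hy]
  have hGF : ∀ x ∈ closedBall x₀ r, G x = F x := fun x hx => by
    simp [hG, χ.one_of_mem_closedBall hx]
  have h := integral_ball_zero_fderiv
    (hGd.comp (contDiff_const.add contDiff_id) : ContDiff ℝ 1 (G ∘ fun x => x₀ + x)) e hr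
  have hl : ∫ x in ball (0 : E) r, fderiv ℝ (G ∘ fun x => x₀ + x) x e
      = ∫ x in ball x₀ r, fderiv ℝ F x e := by
    have hpre : (fun x => x₀ + x) ⁻¹' ball x₀ r = ball (0 : E) r := by
      ext x
      simp
    rw [← (measurePreserving_add_left volume x₀).setIntegral_preimage_emb
      (measurableEmbedding_addLeft x₀) _ (ball x₀ r), hpre]
    refine setIntegral_congr_fun measurableSet_ball fun x hx => ?_
    have hx' : x₀ + x ∈ ball x₀ r := by simpa using hx
    have : G =ᶠ[𝓝 (x₀ + x)] F := by
      filter_upwards [isOpen_ball.mem_nhds hx'] with y hy using hGF y (ball_subset_closedBall hy)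
    simp only [Function.comp_def, fderiv_comp_add_left, this.fderiv_eq]
  rw [← hl, h]
  congr 1
  refine integral_congr_ae (Eventually.of_forall fun θ => ?_)
  simp only [Function.comp]
  rw [hGF]
  simp [norm_smul, abs_of_pos hr]

end DivergenceTheorem

/-- The divergence theorem on a ball of `ℝ^N`. -/
theorem integral_ball_divergence {N : ℕ} [NeZero N] {Ω : Set (EuclideanSpace ℝ (Fin N))}
    (hΩ : IsOpen Ω) {V : Fin N → EuclideanSpace ℝ (Fin N) → ℝ} (hV : ∀ i, ContDiffOn ℝ 1 (V i) Ω)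
    {x₀ : EuclideanSpace ℝ (Fin N)} {r : ℝ} (hr : 0 < r) (hball : closedBall x₀ r ⊆ Ω) :
    ∫ x in ball x₀ r, ∑ i, fderiv ℝ (V i) x (EuclideanSpace.single i 1)
      = sphereIntegral N x₀ r fun x ν => ∑ i, V i x * ν i := by
  have hmaps : ∀ θ : sphere (0 : EuclideanSpace ℝ (Fin N)) 1,
      x₀ + r • (θ : EuclideanSpace ℝ (Fin N)) ∈ Ω := fun θ => hball (by
    simp [norm_smul, abs_of_pos hr])
  rw [integral_finsetSum, sphereIntegral, integral_finsetSum, Finset.mul_sum]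
  · refine Finset.sum_congr rfl fun i _ => ?_
    rw [integral_ball_fderiv hΩ (hV i) hr hball]
    simp [EuclideanSpace.inner_single_right, mul_comm]
  · intro i _
    have hc : Continuous fun θ : sphere (0 : EuclideanSpace ℝ (Fin N)) 1 =>
        V i (x₀ + r • (θ : EuclideanSpace ℝ (Fin N))) * (θ : EuclideanSpace ℝ (Fin N)) i :=
      ((hV i).continuousOn.comp_continuous (by fun_prop) hmaps).mul (by fun_prop)
    exact hc.integrable_of_hasCompactSupport (HasCompactSupport.of_compactSpace _)
  · intro i _
    have hc : ContinuousOn (fun x => fderiv ℝ (V i) x (EuclideanSpace.single i 1)) Ω :=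
      ((hV i).continuousOn_fderiv_of_isOpen hΩ le_rfl).clm_apply continuousOn_const
    exact ((hc.mono hball).integrableOn_compact (isCompact_closedBall x₀ r)).mono_set
      ball_subset_closedBall

section Pohozaev

variable {N : ℕ}

lemma fderiv_apply_eq_sum (f : EuclideanSpace ℝ (Fin N) → ℝ) (x v : EuclideanSpace ℝ (Fin N)) :
    fderiv ℝ f x v = ∑ i, v i * fderiv ℝ f x (EuclideanSpace.single i 1) := by
  conv_lhs => rw [← (EuclideanSpace.basisFun (Fin N) ℝ).sum_repr v]
  simp

lemma norm_gradient_sq (f : EuclideanSpace ℝ (Fin N) → ℝ) (x : EuclideanSpace ℝ (Fin N)) :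
    ‖gradient f x‖ ^ 2 = ∑ i, fderiv ℝ f x (EuclideanSpace.single i 1) ^ 2 := by
  rw [EuclideanSpace.norm_sq_eq]
  refine Finset.sum_congr rfl fun i _ => ?_
  have : gradient f x i = fderiv ℝ f x (EuclideanSpace.single i 1) := by
    rw [← inner_gradient_left, EuclideanSpace.inner_single_right]
    simp
  rw [this, Real.norm_eq_abs, sq_abs]

/-- The `i`-th component of the vector field whose flux through a sphere is the boundary term of
the Pohozaev identity. -/
def pohozaevField (Q u : EuclideanSpace ℝ (Fin N) → ℝ) (ε s p : ℝ) (b : EuclideanSpace ℝ (Fin N))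
    (i : Fin N) (x : EuclideanSpace ℝ (Fin N)) : ℝ :=
  (1 / p * Q x * u x ^ p + ε / (s + 1) * u x ^ (s + 1)
      - 1 / 2 * ∑ j, fderiv ℝ u x (EuclideanSpace.single j 1) ^ 2) * (x i - b i)
    + (∑ j, (x j - b j) * fderiv ℝ u x (EuclideanSpace.single j 1) + ((N : ℝ) - 2) / 2 * u x)
      * fderiv ℝ u x (EuclideanSpace.single i 1)

variable {Ω : Set (EuclideanSpace ℝ (Fin N))} {Q u : EuclideanSpace ℝ (Fin N) → ℝ}

lemma contDiffOn_fderiv_apply (hΩ : IsOpen Ω) (hu : ContDiffOn ℝ 2 u Ω)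
    (v : EuclideanSpace ℝ (Fin N)) : ContDiffOn ℝ 1 (fun x => fderiv ℝ u x v) Ω :=
  (hu.fderiv_of_isOpen hΩ (by norm_num)).clm_apply contDiffOn_const

lemma contDiffOn_pohozaevField (hΩ : IsOpen Ω) (hQ : ContDiffOn ℝ 1 Q Ω) (hu : ContDiffOn ℝ 2 u Ω)
    (hupos : ∀ x ∈ Ω, 0 < u x) (ε s p : ℝ) (b : EuclideanSpace ℝ (Fin N)) (i : Fin N) :
    ContDiffOn ℝ 1 (pohozaevField Q u ε s p b i) Ω := by
  have hu1 : ContDiffOn ℝ 1 u Ω := hu.of_le one_le_two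
  have hP := contDiffOn_fderiv_apply hΩ hu
  have hpow : ∀ q : ℝ, ContDiffOn ℝ 1 (fun x => u x ^ q) Ω := fun q =>
    hu1.rpow_const_of_ne fun x hx => (hupos x hx).ne'
  have hX : ∀ j, ContDiffOn ℝ 1 (fun x : EuclideanSpace ℝ (Fin N) => x j - b j) Ω := fun j => by
    fun_prop
  unfold pohozaevField
  exact (((((contDiffOn_const.mul hQ).mul (hpow p)).add (contDiffOn_const.mul (hpow (s + 1)))).sub
    (contDiffOn_const.mul (ContDiffOn.sum fun j _ => (hP _).pow 2))).mul (hX i)).add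
    (((ContDiffOn.sum fun j _ => (hX j).mul (hP _)).add (contDiffOn_const.mul hu1)).mul (hP _))

lemma fderiv_pohozaevField (hΩ : IsOpen Ω) (hQ : ContDiffOn ℝ 1 Q Ω) (hu : ContDiffOn ℝ 2 u Ω)
    (hupos : ∀ x ∈ Ω, 0 < u x) {ε s p : ℝ} (hs : s + 1 ≠ 0) (hp : p ≠ 0)
    (b : EuclideanSpace ℝ (Fin N)) (i : Fin N) {x : EuclideanSpace ℝ (Fin N)} (hx : x ∈ Ω)
    {P q : Fin N → ℝ} {H : Fin N → Fin N → ℝ}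
    (hP : ∀ j, fderiv ℝ u x (EuclideanSpace.single j 1) = P j)
    (hq : ∀ j, fderiv ℝ Q x (EuclideanSpace.single j 1) = q j)
    (hH : ∀ i j, fderiv ℝ (fun y => fderiv ℝ u y (EuclideanSpace.single j 1)) x
      (EuclideanSpace.single i 1) = H i j) :
    fderiv ℝ (pohozaevField Q u ε s p b i) x (EuclideanSpace.single i 1)
      = (1 / p * q i * u x ^ p + Q x * u x ^ (p - 1) * P i + ε * u x ^ s * P i
          - ∑ j, P j * H i j) * (x i - b i)
        + (1 / p * Q x * u x ^ p + ε / (s + 1) * u x ^ (s + 1) - 1 / 2 * ∑ j, P j ^ 2)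
        + (P i + ∑ j, (x j - b j) * H i j + ((N : ℝ) - 2) / 2 * P i) * P i
        + (∑ j, (x j - b j) * P j + ((N : ℝ) - 2) / 2 * u x) * H i i := by
  have hnhds := hΩ.mem_nhds hx
  have hQd := ((hQ.contDiffAt hnhds).differentiableAt one_ne_zero).hasFDerivAt
  have hud := ((hu.contDiffAt hnhds).differentiableAt two_ne_zero).hasFDerivAt
  have hPd := fun j => ((((contDiffOn_fderiv_apply hΩ hu (EuclideanSpace.single j 1)).contDiffAt
    hnhds).differentiableAt one_ne_zero).hasFDerivAt)
  have hX : ∀ j, HasFDerivAt (fun x : EuclideanSpace ℝ (Fin N) => x j - b j)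
      (EuclideanSpace.proj j : EuclideanSpace ℝ (Fin N) →L[ℝ] ℝ) x := fun j =>
    (EuclideanSpace.proj j : EuclideanSpace ℝ (Fin N) →L[ℝ] ℝ).hasFDerivAt.sub_const _
  have hpow : ∀ t : ℝ, HasFDerivAt (fun x => u x ^ t) ((t * u x ^ (t - 1)) • fderiv ℝ u x) x :=
    fun t => hud.rpow_const (Or.inl (hupos x hx).ne')
  have hd := (((((hQd.const_mul (1 / p)).mul (hpow p)).add
      ((hpow (s + 1)).const_mul (ε / (s + 1)))).sub
      ((HasFDerivAt.fun_sum (u := Finset.univ) fun j _ => (hPd j).pow 2).const_mul (1 / 2))).mul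
      (hX i)).add
    (((HasFDerivAt.fun_sum (u := Finset.univ) fun j _ => (hX j).mul (hPd j)).add
      (hud.const_mul (((N : ℝ) - 2) / 2))).mul (hPd i))
  have hd' : HasFDerivAt (pohozaevField Q u ε s p b i) _ x := hd
  rw [hd'.fderiv]
  simp [hP, hq, hH, Finset.sum_add_distrib]
  have hp1 : p⁻¹ * p = 1 := inv_mul_cancel₀ hp
  have hs1 : ε / (s + 1) * (s + 1) = ε := div_mul_cancel₀ ε hs
  have hsum : ∑ j, 2 * P j * H i j = 2 * ∑ j, P j * H i j := by
    simp only [Finset.mul_sum, mul_assoc]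
  rw [hsum]
  linear_combination (x i - b i) * (Q x * u x ^ (p - 1) * P i * hp1 + u x ^ s * P i * hs1)

lemma sum_fderiv_pohozaevField (hN : 2 < N) (hΩ : IsOpen Ω) (hQ : ContDiffOn ℝ 1 Q Ω)
    (hu : ContDiffOn ℝ 2 u Ω) (hupos : ∀ x ∈ Ω, 0 < u x) {ε s p : ℝ} (hs : s + 1 ≠ 0)
    (hp : p = 2 * N / ((N : ℝ) - 2))
    (b : EuclideanSpace ℝ (Fin N)) {x : EuclideanSpace ℝ (Fin N)} (hx : x ∈ Ω)
    (hpde : -laplacian u x = Q x * u x ^ (p - 1) + ε * u x ^ s) :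
    ∑ i, fderiv ℝ (pohozaevField Q u ε s p b i) x (EuclideanSpace.single i 1)
      = 1 / p * (fderiv ℝ Q x (x - b) * u x ^ p)
        + (1 - (N : ℝ) / 2 + N / (1 + s)) * ε * u x ^ (s + 1) := by
  have hN' : (2 : ℝ) < N := by exact_mod_cast hN
  have hp0 : p ≠ 0 := by
    rw [hp]
    have : 0 < (N : ℝ) - 2 := by linarith
    positivity
  have hNp : N * (1 / p) = ((N : ℝ) - 2) / 2 := by
    rw [hp]
    field_simp
  have hup : u x ^ p = u x ^ (p - 1) * u x := by
    rw [← rpow_add_one (hupos x hx).ne', sub_add_cancel]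
  have hus : u x ^ (s + 1) = u x ^ s * u x := rpow_add_one (hupos x hx).ne' s
  set P : Fin N → ℝ := fun j => fderiv ℝ u x (EuclideanSpace.single j 1) with hP
  set q : Fin N → ℝ := fun j => fderiv ℝ Q x (EuclideanSpace.single j 1) with hq
  set H : Fin N → Fin N → ℝ := fun i j =>
    fderiv ℝ (fun y => fderiv ℝ u y (EuclideanSpace.single j 1)) x (EuclideanSpace.single i 1)
    with hH
  have hsymm : ∀ i j, H i j = H j i := by
    intro i j
    have hcd := hu.contDiffAt (hΩ.mem_nhds hx)
    have hdd : DifferentiableAt ℝ (fderiv ℝ u) x :=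
      (hcd.fderiv_right (m := 1) (by norm_num)).differentiableAt one_ne_zero
    have hHe : ∀ i j, H i j = fderiv ℝ (fderiv ℝ u) x (EuclideanSpace.single i 1)
        (EuclideanSpace.single j 1) := fun i j => by
      simp only [hH]
      rw [fderiv_clm_apply hdd (differentiableAt_const _)]
      simp
    rw [hHe, hHe]
    exact hcd.isSymmSndFDerivAt (by simp) _ _
  have hlap : ∑ i, H i i = -(Q x * u x ^ (p - 1) + ε * u x ^ s) := by
    rw [← hpde, neg_neg]
    rfl
  have hswap : ∑ i, (∑ j, P j * H i j) * (x i - b i) = ∑ i, (∑ j, (x j - b j) * H i j) * P i := by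
    simp only [Finset.sum_mul]
    rw [Finset.sum_comm]
    refine Finset.sum_congr rfl fun i _ => Finset.sum_congr rfl fun j _ => ?_
    rw [hsymm j i]
    ring
  have hQx : fderiv ℝ Q x (x - b) = ∑ i, q i * (x i - b i) := by
    rw [fderiv_apply_eq_sum]
    exact Finset.sum_congr rfl fun i _ => by simp [hq, mul_comm]
  set S := ∑ j, (x j - b j) * P j with hS
  set G := ∑ j, P j ^ 2 with hG
  set φ := 1 / p * Q x * u x ^ p + ε / (s + 1) * u x ^ (s + 1) - 1 / 2 * G with hφ
  have hterm : ∀ i, fderiv ℝ (pohozaevField Q u ε s p b i) x (EuclideanSpace.single i 1)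
      = 1 / p * u x ^ p * (q i * (x i - b i))
        + (Q x * u x ^ (p - 1) + ε * u x ^ s) * ((x i - b i) * P i)
        - (∑ j, P j * H i j) * (x i - b i) + φ + (1 + ((N : ℝ) - 2) / 2) * P i ^ 2
        + (∑ j, (x j - b j) * H i j) * P i + (S + ((N : ℝ) - 2) / 2 * u x) * H i i := fun i => by
    rw [fderiv_pohozaevField hΩ hQ hu hupos hs hp0 b i hx (P := P) (q := q) (H := H)
      (fun _ => rfl) (fun _ => rfl) fun _ _ => rfl]
    ring
  simp only [hterm, Finset.sum_add_distrib, Finset.sum_sub_distrib, ← Finset.mul_sum, hswap, hlap,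
    ← hS, ← hG, ← hQx, Finset.sum_const, Finset.card_univ, Fintype.card_fin, nsmul_eq_mul, hφ]
  rw [hup, hus]
  have hs' : 1 + s ≠ 0 := by rwa [add_comm]
  rw [add_comm 1 s]
  linear_combination (Q x * u x ^ (p - 1) * u x) * hNp

end Pohozaev

/-- **Dilation-type local Pohozaev identity.**
If `u ∈ C²(Ω)` is positive and solves `-Δu = Q(x) u^{2*-1} + ε u^s` in an open set `Ω ⊆ ℝ^N`
(`N ≥ 3`, `2* = 2N/(N-2)`, `Q ∈ C¹(Ω)`, `ε ≥ 0`, `s ≥ 1`), then for every closed ball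
`closedBall x₀ r ⊆ Ω` (with `r > 0`) and every base point `b ∈ ℝ^N`,
`(1/2*) ∫_{B_r(x₀)} ((x-b)·∇Q) u^{2*} + (1 - N/2 + N/(1+s)) ε ∫_{B_r(x₀)} u^{s+1}
  = ∫_{∂B_r(x₀)} [ ( (1/2*) Q u^{2*} + ε u^{s+1}/(s+1) - |∇u|²/2 ) ((x-b)·ν)
      + ( (x-b)·∇u + ((N-2)/2) u ) ∂_ν u ] dσ`,
where `ν(x) = (x - x₀)/r` is the outward unit normal. -/
theorem dilation_pohozaev
    (N : ℕ) (hN : 3 ≤ N)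
    (Ω : Set (EuclideanSpace ℝ (Fin N))) (hΩ : IsOpen Ω)
    (Q u : EuclideanSpace ℝ (Fin N) → ℝ)
    (hQ : ContDiffOn ℝ 1 Q Ω)
    (ε s : ℝ) (hε : 0 ≤ ε) (hs : 1 ≤ s)
    (hu : ContDiffOn ℝ 2 u Ω)
    (hupos : ∀ x ∈ Ω, 0 < u x)
    (hpde : ∀ x ∈ Ω,
      -laplacian u x = Q x * u x ^ ((2 * N : ℝ) / ((N : ℝ) - 2) - 1) + ε * u x ^ s)
    (x₀ : EuclideanSpace ℝ (Fin N)) (r : ℝ) (hr : 0 < r)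
    (hball : Metric.closedBall x₀ r ⊆ Ω)
    (b : EuclideanSpace ℝ (Fin N)) :
    (1 / ((2 * N : ℝ) / ((N : ℝ) - 2))) *
        (∫ x in Metric.ball x₀ r,
          (fderiv ℝ Q x (x - b)) * u x ^ ((2 * N : ℝ) / ((N : ℝ) - 2)))
      + (1 - (N : ℝ) / 2 + (N : ℝ) / (1 + s)) * ε *
          (∫ x in Metric.ball x₀ r, u x ^ (s + 1))
      = sphereIntegral N x₀ r (fun x ν =>
          ((1 / ((2 * N : ℝ) / ((N : ℝ) - 2))) * Q x * u x ^ ((2 * N : ℝ) / ((N : ℝ) - 2))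
              + (ε / (s + 1)) * u x ^ (s + 1)
              - (1 / 2) * ‖gradient u x‖ ^ 2) * ⟪x - b, ν⟫
          + ((fderiv ℝ u x (x - b)) + (((N : ℝ) - 2) / 2) * u x) * (fderiv ℝ u x ν)) := by
  have : NeZero N := ⟨by omega⟩
  set p : ℝ := (2 * N : ℝ) / ((N : ℝ) - 2) with hp
  have hs1 : s + 1 ≠ 0 := by linarith
  have hu1 : ContinuousOn u Ω := hu.continuousOn
  have hpow : ∀ q : ℝ, ContinuousOn (fun x => u x ^ q) Ω := fun q =>
    hu1.rpow_const fun x hx => Or.inl (hupos x hx).ne'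
  have hint : ∀ {f : EuclideanSpace ℝ (Fin N) → ℝ}, ContinuousOn f Ω →
      IntegrableOn f (ball x₀ r) := fun hf =>
    ((hf.mono hball).integrableOn_compact (isCompact_closedBall x₀ r)).mono_set
      ball_subset_closedBall
  rw [← integral_const_mul, ← integral_const_mul, ← integral_add]
  · have hdiv := integral_ball_divergence hΩ
      (contDiffOn_pohozaevField hΩ hQ hu hupos ε s p b) hr hball
    rw [setIntegral_congr_fun measurableSet_ball fun x hx =>
      sum_fderiv_pohozaevField hN hΩ hQ hu hupos hs1 hp b (hball (ball_subset_closedBall hx))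
        (hpde x (hball (ball_subset_closedBall hx)))] at hdiv
    rw [hdiv]
    congr 1
    funext x ν
    rw [norm_gradient_sq, fderiv_apply_eq_sum u x (x - b), fderiv_apply_eq_sum u x ν]
    simp only [pohozaevField, PiLp.inner_apply, add_mul, Finset.sum_add_distrib, mul_assoc,
      ← Finset.mul_sum]
    simp [mul_comm]
  · exact (hint (((hQ.continuousOn_fderiv_of_isOpen hΩ le_rfl).clm_apply (by fun_prop)).mul
      (hpow p))).const_mul _
  · exact (hint (hpow (s + 1))).const_mul _

end
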